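/- Let n ≥ 1, ν₀ ∈ ℝ, and let h_{αβ} : ℝ^n → ℝ^{n×n} be a smooth family of invertible symmetric matrices with constant-curvature Riemann tensor R^{(h)α}{}_{βγδ} = ν₀ ( δ^α_γ h_{δβ} − δ^α_δ h_{γβ} ), and let k_{αβ}(y) be a smooth symmetric 2-tensor on ℝ^n. On ℝ × ℝ^n with coordinates (u,y) define the induced Carrollian connection: Γ^α_{βγ} = Levi-Civita Christoffels of h, Γ^u_{βγ}(u,y) = ν₀ ( ½ k_{βγ}(y) + u h_{βγ}(y) ), all other components zero. Then its curvature R^a{}_{bcd} = ∂_cΓ^a_{db} − ∂_dΓ^a_{cb} + Σ_e(Γ^a_{ce}Γ^e_{db} − Γ^a_{de}Γ^e_{cb}) has components: R^u{}_{β u γ} = ν₀ h_{βγ}, R^u{}_{βγδ} = (ν₀/2)( D_γ k_{δβ} − D_δ k_{γβ} ), R^α{}_{βγδ} = R^{(h)α}{}_{βγδ}, and all other components vanish, where D is the Levi-Civita covariant derivative of h. -/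

import Mathlib

open scoped BigOperators
open Filter MeasureTheory

noncomputable section

/-- Partial derivative in the `i`-th coordinate direction. -/
def pdv {m : ℕ} {F : Type*} [NormedAddCommGroup F] [NormedSpace ℝ F]
    (i : Fin m) (f : (Fin m → ℝ) → F) (x : Fin m → ℝ) : F :=
  fderiv ℝ f x (Pi.single i 1)

/-- Extension of a spatial 2-tensor on `ℝⁿ` by zero to adapted coordinates on `ℝ × ℝⁿ`. -/
def spatialExt (n : ℕ) (T : Fin n → Fin n → ℝ) (b c : Fin (n+1)) : ℝ :=
  Fin.cases (motive := fun _ => ℝ) 0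
    (fun β => Fin.cases (motive := fun _ => ℝ) 0 (fun γ => T β γ) c) b

/-- Christoffel symbols `Γ^γ_{αβ}` of a metric `h_{αβ}` on `ℝⁿ` (via the matrix inverse). -/
def ChrG (n : ℕ) (hmat : (Fin n → ℝ) → Fin n → Fin n → ℝ)
    (y : Fin n → ℝ) (γ α β : Fin n) : ℝ :=
  (1/2) * ∑ δ, (Matrix.of (hmat y))⁻¹ γ δ *
    (pdv α (fun y => hmat y δ β) y + pdv β (fun y => hmat y δ α) y
      - pdv δ (fun y => hmat y α β) y)

/-- The Riemann curvature tensor `R^α_{βγδ}` of a metric `h_{αβ}` on `ℝⁿ`. -/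
def Riem (n : ℕ) (hmat : (Fin n → ℝ) → Fin n → Fin n → ℝ)
    (y : Fin n → ℝ) (α β γ δ : Fin n) : ℝ :=
  pdv γ (fun y => ChrG n hmat y α δ β) y - pdv δ (fun y => ChrG n hmat y α γ β) y
    + ∑ ε, (ChrG n hmat y α γ ε * ChrG n hmat y ε δ β
        - ChrG n hmat y α δ ε * ChrG n hmat y ε γ β)

/-- The Levi-Civita covariant derivative `D_γ k_{δβ}` of a 2-tensor `k` on `ℝⁿ`. -/
def covDk (n : ℕ) (hmat kmat : (Fin n → ℝ) → Fin n → Fin n → ℝ)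
    (y : Fin n → ℝ) (γ δ β : Fin n) : ℝ :=
  pdv γ (fun y => kmat y δ β) y
    - (∑ ε, ChrG n hmat y ε γ δ * kmat y ε β)
    - (∑ ε, ChrG n hmat y ε γ β * kmat y δ ε)

/-- The Carrollian connection induced on `Spi/Ti`:
`Γ^α_{βγ}` are the Christoffel symbols of `h` and `Γ^u_{βγ} = ν₀(½k_{βγ} + u h_{βγ})`;
all other components vanish.  The first index is the upper one. -/
def Γind (n : ℕ) (ν₀ : ℝ) (hmat kmat : (Fin n → ℝ) → Fin n → Fin n → ℝ)
    (x : Fin (n+1) → ℝ) (a b c : Fin (n+1)) : ℝ :=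
  Fin.cases (motive := fun _ => ℝ)
    (spatialExt n
      (fun β γ => ν₀ * ((1/2) * kmat (x ∘ Fin.succ) β γ + x 0 * hmat (x ∘ Fin.succ) β γ))
      b c)
    (fun α => spatialExt n (fun β γ => ChrG n hmat (x ∘ Fin.succ) α β γ) b c)
    a

/-- The curvature of a connection on `ℝ × ℝⁿ`. -/
def Rfull (n : ℕ) (Γ : (Fin (n+1) → ℝ) → Fin (n+1) → Fin (n+1) → Fin (n+1) → ℝ)
    (x : Fin (n+1) → ℝ) (a b c d : Fin (n+1)) : ℝ :=
  pdv c (fun x => Γ x a d b) x - pdv d (fun x => Γ x a c b) x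
    + ∑ e, (Γ x a c e * Γ x e d b - Γ x a d e * Γ x e c b)

section SpatialExt

variable (n : ℕ) (T : Fin n → Fin n → ℝ)

@[simp] lemma spatialExt_zero_left (c : Fin (n+1)) : spatialExt n T 0 c = 0 := rfl

@[simp] lemma spatialExt_zero_right (b : Fin (n+1)) : spatialExt n T b 0 = 0 := by
  cases b using Fin.cases <;> rfl

@[simp] lemma spatialExt_succ_succ (β γ : Fin n) :
    spatialExt n T β.succ γ.succ = T β γ := rfl

end SpatialExt

section InducedConnection

variable (n : ℕ) (ν₀ : ℝ) (hmat kmat : (Fin n → ℝ) → Fin n → Fin n → ℝ)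
  (x : Fin (n+1) → ℝ)

@[simp] lemma Γind_zero_left (a c : Fin (n+1)) : Γind n ν₀ hmat kmat x a 0 c = 0 := by
  cases a using Fin.cases <;> rfl

@[simp] lemma Γind_zero_right (a b : Fin (n+1)) : Γind n ν₀ hmat kmat x a b 0 = 0 := by
  cases a using Fin.cases <;> simp [Γind]

@[simp] lemma Γind_zero_succ_succ (β γ : Fin n) :
    Γind n ν₀ hmat kmat x 0 β.succ γ.succ
      = ν₀ * ((1/2) * kmat (x ∘ Fin.succ) β γ + x 0 * hmat (x ∘ Fin.succ) β γ) := rfl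

@[simp] lemma Γind_succ_succ_succ (α β γ : Fin n) :
    Γind n ν₀ hmat kmat x α.succ β.succ γ.succ = ChrG n hmat (x ∘ Fin.succ) α β γ := rfl

end InducedConnection

section PartialDerivative

variable {n : ℕ}

@[simp] lemma pdv_const {m : ℕ} (i : Fin m) (c : ℝ) (x : Fin m → ℝ) :
    pdv i (fun _ => c) x = 0 := by
  simp [pdv]

/-- Restriction to the spatial coordinates as a continuous linear map. -/
def spatialProj (n : ℕ) : (Fin (n+1) → ℝ) →L[ℝ] (Fin n → ℝ) :=
  ContinuousLinearMap.pi fun i => ContinuousLinearMap.proj i.succ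

lemma spatialProj_apply (x : Fin (n+1) → ℝ) : spatialProj n x = x ∘ Fin.succ := rfl

lemma hasFDerivAt_comp_succ {f : (Fin n → ℝ) → ℝ} {x : Fin (n+1) → ℝ}
    (hf : DifferentiableAt ℝ f (x ∘ Fin.succ)) :
    HasFDerivAt (fun x : Fin (n+1) → ℝ => f (x ∘ Fin.succ))
      ((fderiv ℝ f (x ∘ Fin.succ)).comp (spatialProj n)) x :=
  HasFDerivAt.comp (f := spatialProj n) x hf.hasFDerivAt (spatialProj n).hasFDerivAt

lemma differentiableAt_of_comp_succ {f : (Fin n → ℝ) → ℝ} {x : Fin (n+1) → ℝ}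
    (hf : DifferentiableAt ℝ (fun x : Fin (n+1) → ℝ => f (x ∘ Fin.succ)) x) :
    DifferentiableAt ℝ f (x ∘ Fin.succ) := by
  have hs : DifferentiableAt ℝ (fun y : Fin n → ℝ => (Fin.cons (x 0) y : Fin (n+1) → ℝ))
      (x ∘ Fin.succ) := by
    rw [differentiableAt_pi]
    intro i
    cases i using Fin.cases with
    | zero => simp
    | succ i => simpa using differentiableAt_apply i _
  have hx : (Fin.cons (x 0) (x ∘ Fin.succ) : Fin (n+1) → ℝ) = x := Fin.cons_self_tail x
  rw [← hx] at hf
  have h := DifferentiableAt.comp (x ∘ Fin.succ)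
    (f := fun y : Fin n → ℝ => (Fin.cons (x 0) y : Fin (n+1) → ℝ)) hf hs
  exact h

lemma fderiv_comp_succ (f : (Fin n → ℝ) → ℝ) (x : Fin (n+1) → ℝ) :
    fderiv ℝ (fun x : Fin (n+1) → ℝ => f (x ∘ Fin.succ)) x
      = (fderiv ℝ f (x ∘ Fin.succ)).comp (spatialProj n) := by
  by_cases hf : DifferentiableAt ℝ f (x ∘ Fin.succ)
  · exact (hasFDerivAt_comp_succ hf).fderiv
  · rw [fderiv_zero_of_not_differentiableAt hf,
      fderiv_zero_of_not_differentiableAt fun h => hf (differentiableAt_of_comp_succ h)]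
    simp

lemma spatialProj_single_zero : spatialProj n (Pi.single 0 1) = 0 := by
  ext i
  simp [spatialProj_apply]

lemma spatialProj_single_succ (γ : Fin n) :
    spatialProj n (Pi.single γ.succ 1) = Pi.single γ 1 := by
  ext i
  simp [spatialProj_apply, Pi.single_apply]

@[simp] lemma pdv_zero_comp_succ (f : (Fin n → ℝ) → ℝ) (x : Fin (n+1) → ℝ) :
    pdv 0 (fun x : Fin (n+1) → ℝ => f (x ∘ Fin.succ)) x = 0 := by
  simp [pdv, fderiv_comp_succ, spatialProj_single_zero]

lemma pdv_succ_comp_succ (γ : Fin n) (f : (Fin n → ℝ) → ℝ) (x : Fin (n+1) → ℝ) :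
    pdv γ.succ (fun x : Fin (n+1) → ℝ => f (x ∘ Fin.succ)) x = pdv γ f (x ∘ Fin.succ) := by
  simp [pdv, fderiv_comp_succ, spatialProj_single_succ]

lemma fderiv_affine_in_zero (ν : ℝ) {f g : (Fin n → ℝ) → ℝ} (x v : Fin (n+1) → ℝ)
    (hf : DifferentiableAt ℝ f (x ∘ Fin.succ)) (hg : DifferentiableAt ℝ g (x ∘ Fin.succ)) :
    fderiv ℝ (fun x : Fin (n+1) → ℝ =>
        ν * ((1/2) * f (x ∘ Fin.succ) + x 0 * g (x ∘ Fin.succ))) x v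
      = ν * ((1/2) * fderiv ℝ f (x ∘ Fin.succ) (spatialProj n v)
          + x 0 * fderiv ℝ g (x ∘ Fin.succ) (spatialProj n v)
          + v 0 * g (x ∘ Fin.succ)) := by
  have h := (((hasFDerivAt_comp_succ hf).const_mul (1/2)).add
    ((hasFDerivAt_apply (𝕜 := ℝ) (0 : Fin (n+1)) x).mul (hasFDerivAt_comp_succ hg))).const_mul ν
  have h' := congrArg (fun L => L v) h.fderiv
  refine Eq.trans h' ?_
  simp
  ring

end PartialDerivative

section LeviCivita

variable {n : ℕ} {hmat : (Fin n → ℝ) → Fin n → Fin n → ℝ}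

lemma ChrG_symm (hsym : ∀ (y : Fin n → ℝ) (α β : Fin n), hmat y α β = hmat y β α)
    (y : Fin n → ℝ) (γ α β : Fin n) : ChrG n hmat y γ α β = ChrG n hmat y γ β α := by
  have h : (fun y => hmat y α β) = fun y => hmat y β α := funext fun y => hsym y α β
  simp only [ChrG, h]
  congr 1
  exact Finset.sum_congr rfl fun δ _ => by ring

/-- Lowering the upper index of the Christoffel symbols. -/
lemma sum_metric_mul_ChrG (y : Fin n → ℝ) (hinv : IsUnit (Matrix.of (hmat y)).det)
    (δ γ β : Fin n) :
    ∑ ε, hmat y δ ε * ChrG n hmat y ε γ β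
      = (1/2) * (pdv γ (fun y => hmat y δ β) y + pdv β (fun y => hmat y δ γ) y
          - pdv δ (fun y => hmat y γ β) y) := by
  set v : Fin n → ℝ := fun ρ => pdv γ (fun y => hmat y ρ β) y + pdv β (fun y => hmat y ρ γ) y
      - pdv ρ (fun y => hmat y γ β) y with hv
  have hC : (fun ε => ChrG n hmat y ε γ β)
      = (1/2 : ℝ) • ((Matrix.of (hmat y))⁻¹.mulVec v) := by
    ext ε
    simp [ChrG, Matrix.mulVec, dotProduct, hv]
  have h : (Matrix.of (hmat y)).mulVec (fun ε => ChrG n hmat y ε γ β) = (1/2 : ℝ) • v := by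
    rw [hC, Matrix.mulVec_smul, Matrix.mulVec_mulVec, Matrix.mul_nonsing_inv _ hinv,
      Matrix.one_mulVec]
  have h' := congrFun h δ
  simpa [Matrix.mulVec, dotProduct, hv] using h'

/-- The part of metric compatibility seen by the curvature: the exterior covariant derivative
of the metric vanishes. -/
lemma pdv_metric_sub_add_sum_eq_zero
    (hsym : ∀ (y : Fin n → ℝ) (α β : Fin n), hmat y α β = hmat y β α)
    (y : Fin n → ℝ) (hinv : IsUnit (Matrix.of (hmat y)).det) (β γ δ : Fin n) :
    pdv γ (fun y => hmat y δ β) y - pdv δ (fun y => hmat y γ β) y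
      + ((∑ ε, hmat y γ ε * ChrG n hmat y ε δ β)
        - ∑ ε, hmat y δ ε * ChrG n hmat y ε γ β) = 0 := by
  have h : (fun y => hmat y γ δ) = fun y => hmat y δ γ := funext fun y => hsym y γ δ
  rw [sum_metric_mul_ChrG y hinv, sum_metric_mul_ChrG y hinv, h]
  ring

lemma covDk_sub_covDk (hsym : ∀ (y : Fin n → ℝ) (α β : Fin n), hmat y α β = hmat y β α)
    (kmat : (Fin n → ℝ) → Fin n → Fin n → ℝ) (y : Fin n → ℝ) (β γ δ : Fin n) :
    covDk n hmat kmat y γ δ β - covDk n hmat kmat y δ γ β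
      = pdv γ (fun y => kmat y δ β) y - pdv δ (fun y => kmat y γ β) y
        + ((∑ ε, kmat y γ ε * ChrG n hmat y ε δ β)
          - ∑ ε, kmat y δ ε * ChrG n hmat y ε γ β) := by
  simp only [covDk, ChrG_symm hsym y _ δ γ, mul_comm (kmat y _ _)]
  ring

end LeviCivita

/-- The curvature of the induced Carrollian connection at `Spi/Ti` has components
`R^u_{βuγ} = ν₀h_{βγ}`, `R^u_{βγδ} = (ν₀/2)(D_γk_{δβ} - D_δk_{γβ})`,
`R^α_{βγδ} = R^{(h)α}_{βγδ}`, and all other components vanish (up to the antisymmetry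
of the curvature in its last two indices). -/
theorem carrollian_curvature_of_induced_connection
    (n : ℕ) (hn : 1 ≤ n) (ν₀ : ℝ)
    (hmat : (Fin n → ℝ) → Fin n → Fin n → ℝ)
    (hsm : ContDiff ℝ (⊤ : ℕ∞) hmat)
    (hsym : ∀ (y : Fin n → ℝ) (α β : Fin n), hmat y α β = hmat y β α)
    (hinvert : ∀ y : Fin n → ℝ, IsUnit (Matrix.of (hmat y)).det)
    (hconst : ∀ (y : Fin n → ℝ) (α β γ δ : Fin n),
      Riem n hmat y α β γ δ
        = ν₀ * ((if α = γ then 1 else 0) * hmat y δ β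
            - (if α = δ then 1 else 0) * hmat y γ β))
    (kmat : (Fin n → ℝ) → Fin n → Fin n → ℝ)
    (ksm : ContDiff ℝ (⊤ : ℕ∞) kmat)
    (ksym : ∀ (y : Fin n → ℝ) (α β : Fin n), kmat y α β = kmat y β α) :
    (∀ (x : Fin (n+1) → ℝ) (β γ : Fin n),
      Rfull n (Γind n ν₀ hmat kmat) x 0 β.succ 0 γ.succ = ν₀ * hmat (x ∘ Fin.succ) β γ) ∧
    (∀ (x : Fin (n+1) → ℝ) (β γ δ : Fin n),
      Rfull n (Γind n ν₀ hmat kmat) x 0 β.succ γ.succ δ.succ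
        = (ν₀/2) * (covDk n hmat kmat (x ∘ Fin.succ) γ δ β
            - covDk n hmat kmat (x ∘ Fin.succ) δ γ β)) ∧
    (∀ (x : Fin (n+1) → ℝ) (α β γ δ : Fin n),
      Rfull n (Γind n ν₀ hmat kmat) x α.succ β.succ γ.succ δ.succ
        = Riem n hmat (x ∘ Fin.succ) α β γ δ) ∧
    (∀ (x : Fin (n+1) → ℝ) (a b c d : Fin (n+1)),
      Rfull n (Γind n ν₀ hmat kmat) x a b c d = -(Rfull n (Γind n ν₀ hmat kmat) x a b d c)) ∧
    (∀ (x : Fin (n+1) → ℝ) (a c d : Fin (n+1)),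
      Rfull n (Γind n ν₀ hmat kmat) x a 0 c d = 0) ∧
    (∀ (x : Fin (n+1) → ℝ) (α : Fin n) (b c d : Fin (n+1)), c = 0 ∨ d = 0 →
      Rfull n (Γind n ν₀ hmat kmat) x α.succ b c d = 0) := by
  have hd : ∀ y α β, DifferentiableAt ℝ (fun y => hmat y α β) y := fun y α β =>
    differentiableAt_pi.1 (differentiableAt_pi.1 (hsm.differentiable (by simp) y) α) β
  have kd : ∀ y α β, DifferentiableAt ℝ (fun y => kmat y α β) y := fun y α β =>
    differentiableAt_pi.1 (differentiableAt_pi.1 (ksm.differentiable (by simp) y) α) β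
  refine ⟨fun x β γ => ?_, fun x β γ δ => ?_, fun x α β γ δ => ?_, fun x a b c d => ?_,
    fun x a c d => ?_, fun x α b c d hcd => ?_⟩
  · simp only [Rfull, Γind_zero_left, Γind_zero_succ_succ, pdv_const, mul_zero,
      zero_mul, sub_zero, Finset.sum_const_zero, add_zero]
    unfold pdv
    rw [fderiv_affine_in_zero ν₀ x _ (kd _ γ β) (hd _ γ β), spatialProj_single_zero,
      hsym _ γ β]
    simp
  · have hcompat := pdv_metric_sub_add_sum_eq_zero hsym (x ∘ Fin.succ) (hinvert _) β γ δ
    have hpdv : ∀ γ δ : Fin n, pdv γ.succ (fun x : Fin (n+1) → ℝ =>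
        ν₀ * ((1/2) * kmat (x ∘ Fin.succ) δ β + x 0 * hmat (x ∘ Fin.succ) δ β)) x
        = ν₀ * ((1/2) * pdv γ (fun y => kmat y δ β) (x ∘ Fin.succ)
          + x 0 * pdv γ (fun y => hmat y δ β) (x ∘ Fin.succ)) := fun γ δ => by
      unfold pdv
      rw [fderiv_affine_in_zero ν₀ x _ (kd _ δ β) (hd _ δ β), spatialProj_single_succ]
      simp
    have hsum : ∀ γ δ : Fin n, ∑ ε, ν₀ * ((1/2) * kmat (x ∘ Fin.succ) γ ε
          + x 0 * hmat (x ∘ Fin.succ) γ ε) * ChrG n hmat (x ∘ Fin.succ) ε δ β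
        = ν₀ * ((1/2) * ∑ ε, kmat (x ∘ Fin.succ) γ ε * ChrG n hmat (x ∘ Fin.succ) ε δ β
          + x 0 * ∑ ε, hmat (x ∘ Fin.succ) γ ε * ChrG n hmat (x ∘ Fin.succ) ε δ β) :=
      fun γ δ => by
        simp only [Finset.mul_sum, ← Finset.sum_add_distrib]
        exact Finset.sum_congr rfl fun ε _ => by ring
    rw [covDk_sub_covDk hsym]
    simp only [Rfull, Fin.sum_univ_succ, Γind_zero_right, Γind_zero_succ_succ,
      Γind_succ_succ_succ, zero_mul, zero_add, Finset.sum_sub_distrib, hpdv, hsum]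
    linear_combination ν₀ * x 0 * hcompat
  · simp only [Rfull, Riem, Fin.sum_univ_succ, Γind_zero_right, Γind_succ_succ_succ, zero_mul,
      sub_zero, zero_add]
    rw [pdv_succ_comp_succ γ (fun y => ChrG n hmat y α δ β),
      pdv_succ_comp_succ δ (fun y => ChrG n hmat y α γ β)]
  · simp only [Rfull, Finset.sum_sub_distrib]
    ring
  · simp [Rfull]
  · have hΓ : ∀ d b : Fin (n+1), pdv 0 (fun x => Γind n ν₀ hmat kmat x α.succ d b) x = 0 := by
      intro d b
      cases d using Fin.cases with
      | zero => simp
      | succ δ =>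
        cases b using Fin.cases with
        | zero => simp
        | succ β => exact pdv_zero_comp_succ (fun y => ChrG n hmat y α δ β) x
    rcases hcd with rfl | rfl <;> simp [Rfull, hΓ]
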